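/- arXiv:2202.05966 — 7 statements merged into one kernel-verified Lean document; each statement's English description precedes it below -/
import Mathlib

section
/- For every real number r with |r| ≤ 1, the integral (1/(2π)) ∫₀^{2π} log(1 − r·cos θ) dθ equals log((1 + √(1 − r²))/2). The same value is obtained with sin θ in place of cos θ: (1/(2π)) ∫₀^{2π} log(1 − r·sin θ) dθ = log((1 + √(1 − r²))/2). -/
open Real MeasureTheory intervalIntegral

/-- The mean over the unit circle of `log (C * ‖z - a‖ ^ 2)` is `log C` when `‖a‖ ≤ 1`. -/
lemma integral_log_mul_norm_circleMap_sub_sq {C : ℝ} (hC : C ≠ 0) {a : ℂ} (ha : ‖a‖ ≤ 1) :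
    (1 / (2 * π)) * ∫ θ in (0:ℝ)..(2 * π), Real.log (C * ‖circleMap 0 1 θ - a‖ ^ 2)
      = Real.log C := by
  have hint : IntervalIntegrable (fun θ ↦ Real.log ‖circleMap 0 1 θ - a‖) volume 0 (2 * π) :=
    circleIntegrable_log_norm_sub_const (a := a) (c := 0) 1
  have havg : ∫ θ in (0:ℝ)..(2 * π), Real.log ‖circleMap 0 1 θ - a‖ = 0 := by
    have h := circleAverage_log_norm_sub_const_eq_posLog (a := a)
    rw [circleAverage_def, posLog_eq_zero_iff _ |>.2 (by simpa using ha)] at h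
    simpa [Real.pi_ne_zero] using h
  have hae : ∀ᵐ θ : ℝ, circleMap 0 1 θ ≠ a :=
    ((Set.countable_singleton a).preimage_circleMap 0 one_ne_zero).ae_notMem volume
  have hlog : ∫ θ in (0:ℝ)..(2 * π), Real.log (C * ‖circleMap 0 1 θ - a‖ ^ 2)
      = ∫ θ in (0:ℝ)..(2 * π), (Real.log C + 2 * Real.log ‖circleMap 0 1 θ - a‖) := by
    refine integral_congr_ae ?_
    filter_upwards [hae] with θ hθ _
    have hne : ‖circleMap 0 1 θ - a‖ ≠ 0 := norm_ne_zero_iff.2 (sub_ne_zero.2 hθ)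
    rw [Real.log_mul hC (pow_ne_zero 2 hne), Real.log_pow]
    norm_num
  rw [hlog, integral_add (by simp) (hint.const_mul 2), intervalIntegral.integral_const_mul, havg,
    intervalIntegral.integral_const]
  simp only [smul_eq_mul]
  field_simp
  ring

lemma norm_circleMap_sub_sq (a : ℂ) (θ : ℝ) :
    ‖circleMap 0 1 θ - a‖ ^ 2
      = 1 - 2 * (a.re * Real.cos θ + a.im * Real.sin θ) + ‖a‖ ^ 2 := by
  rw [← Complex.normSq_eq_norm_sq, ← Complex.normSq_eq_norm_sq, Complex.normSq_apply,
    Complex.normSq_apply]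
  simp only [circleMap, Complex.sub_re, Complex.sub_im, zero_add, Complex.ofReal_one, one_mul,
    Complex.exp_ofReal_mul_I_re, Complex.exp_ofReal_mul_I_im]
  linear_combination Real.sin_sq_add_cos_sq θ

theorem stmt_0 (r : ℝ) (hr : |r| ≤ 1) :
    (1 / (2 * π)) * (∫ θ in (0:ℝ)..(2 * π), Real.log (1 - r * Real.cos θ))
      = Real.log ((1 + Real.sqrt (1 - r ^ 2)) / 2) ∧
    (1 / (2 * π)) * (∫ θ in (0:ℝ)..(2 * π), Real.log (1 - r * Real.sin θ))
      = Real.log ((1 + Real.sqrt (1 - r ^ 2)) / 2) := by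
  have hs0 := Real.sqrt_nonneg (1 - r ^ 2)
  have hs2 : Real.sqrt (1 - r ^ 2) ^ 2 = 1 - r ^ 2 :=
    Real.sq_sqrt (sub_nonneg.2 ((sq_le_one_iff_abs_le_one r).2 hr))
  set s := Real.sqrt (1 - r ^ 2)
  have hC : (1 + s) / 2 ≠ 0 := by positivity
  obtain ⟨b, hb⟩ : ∃ b, b = r / (1 + s) := ⟨_, rfl⟩
  have hbr : b * (1 + s) = r := by rw [hb]; field_simp
  have hb1 : |b| ≤ 1 := by
    rw [hb, abs_div, abs_of_pos (by positivity : 0 < 1 + s), div_le_one (by positivity)]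
    linarith
  have hCb : (1 + s) / 2 * (1 + b ^ 2) = 1 := by
    rw [hb]
    field_simp
    linear_combination hs2
  constructor
  · rw [← integral_log_mul_norm_circleMap_sub_sq hC (a := (b : ℂ)) (by simpa using hb1)]
    refine congrArg _ (integral_congr fun θ _ ↦ congrArg Real.log ?_)
    rw [norm_circleMap_sub_sq]
    simp only [Complex.ofReal_re, Complex.ofReal_im, Complex.norm_real, Real.norm_eq_abs, sq_abs]
    linear_combination Real.cos θ * hbr - hCb
  · rw [← integral_log_mul_norm_circleMap_sub_sq hC (a := b * Complex.I) (by simpa using hb1)]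
    refine congrArg _ (integral_congr fun θ _ ↦ congrArg Real.log ?_)
    rw [norm_circleMap_sub_sq]
    simp only [Complex.re_ofReal_mul, Complex.im_ofReal_mul, Complex.I_re, Complex.I_im, norm_mul,
      Complex.norm_I, Complex.norm_real, Real.norm_eq_abs, mul_one, sq_abs]
    linear_combination Real.sin θ * hbr - hCb
end

section
/- Let ξ ∈ (0, π/2) and let u be a real number with cos ξ − √(cos²ξ + 1) < u < 0. Then the logarithmic zeta function of the one-dimensional two-state M-type quantum walk with parameter ξ satisfies ℒ(A^{(m)}, T¹_∞, u) = log((1 − u² + √(1 + 2 cos(2ξ) u² + u⁴))/2); explicitly, (1/(4π)) ∫₀^{2π} log((1 − u²)² + 4 cos²ξ · u² · sin²θ) dθ = log((1 − u² + √(1 + 2 cos(2ξ) u² + u⁴))/2). -/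
open Real MeasureTheory intervalIntegral

lemma norm_circleMap_sub_ofReal_sq (r θ : ℝ) :
    ‖circleMap 0 1 θ - (r : ℂ)‖ ^ 2 = 1 - 2 * r * Real.cos θ + r ^ 2 := by
  have h : circleMap 0 1 θ - (r : ℂ) = ⟨Real.cos θ - r, Real.sin θ⟩ := by
    apply Complex.ext <;>
      simp [circleMap, Complex.exp_ofReal_mul_I_re, Complex.exp_ofReal_mul_I_im]
  rw [h, Complex.sq_norm, Complex.normSq_mk]
  linear_combination Real.sin_sq_add_cos_sq θ

lemma norm_circleMap_sub_ofReal_pos {r : ℝ} (hr : |r| < 1) (θ : ℝ) :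
    0 < ‖circleMap 0 1 θ - (r : ℂ)‖ := by
  refine norm_pos_iff.2 fun h => ?_
  have := congrArg norm (sub_eq_zero.1 h)
  simp at this
  linarith

lemma integral_log_norm_circleMap_sub_ofReal {r : ℝ} (hr : |r| < 1) :
    ∫ θ in (0:ℝ)..(2 * π), Real.log ‖circleMap 0 1 θ - (r : ℂ)‖ = 0 := by
  have h := circleAverage_log_norm_sub_const₀ (a := (r : ℂ)) (by simpa using hr)
  rw [circleAverage_def, smul_eq_mul] at h
  exact (mul_eq_zero.1 h).resolve_left (by positivity)

lemma integral_log_sq_add_sq_mul_sin_sq {a : ℝ} (ha : 0 < a) (b : ℝ) :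
    ∫ θ in (0:ℝ)..(2 * π), Real.log (a ^ 2 + b ^ 2 * Real.sin θ ^ 2)
      = 4 * π * Real.log ((a + Real.sqrt (a ^ 2 + b ^ 2)) / 2) := by
  set s := Real.sqrt (a ^ 2 + b ^ 2) with hs
  have hs2 : s ^ 2 = a ^ 2 + b ^ 2 := Real.sq_sqrt (by positivity)
  have has : a ≤ s := Real.le_sqrt_of_sq_le (by nlinarith [sq_nonneg b])
  set P := (a + s) / 2 with hP
  have hP0 : 0 < P := by linarith
  set r := Real.sqrt ((s - a) / 2 / P)
  have hr2 : P * r ^ 2 = (s - a) / 2 := by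
    rw [Real.sq_sqrt (div_nonneg (by linarith) hP0.le)]
    field_simp
  have hr : |r| < 1 := by
    rw [← sq_lt_one_iff_abs_lt_one]
    by_contra! h
    nlinarith
  have hr' : |-r| < 1 := by rwa [abs_neg]
  have key (θ : ℝ) : Real.log (a ^ 2 + b ^ 2 * Real.sin θ ^ 2)
      = 2 * Real.log P + (2 * Real.log ‖circleMap 0 1 θ - (r : ℂ)‖
        + 2 * Real.log ‖circleMap 0 1 θ - ((-r : ℝ) : ℂ)‖) := by
    have h : a ^ 2 + b ^ 2 * Real.sin θ ^ 2 = P ^ 2 * (‖circleMap 0 1 θ - (r : ℂ)‖ ^ 2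
        * ‖circleMap 0 1 θ - ((-r : ℝ) : ℂ)‖ ^ 2) := by
      rw [norm_circleMap_sub_ofReal_sq, norm_circleMap_sub_ofReal_sq]
      have e : P ^ 2 * ((1 - 2 * r * Real.cos θ + r ^ 2)
          * (1 - 2 * -r * Real.cos θ + (-r) ^ 2))
          = (P + P * r ^ 2) ^ 2 - 4 * P * (P * r ^ 2) * Real.cos θ ^ 2 := by ring
      rw [e, hr2, Real.sin_sq, hP]
      linear_combination (Real.cos θ ^ 2 - 1) * hs2
    have h₁ := norm_circleMap_sub_ofReal_pos hr θ
    have h₂ := norm_circleMap_sub_ofReal_pos hr' θ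
    rw [h, Real.log_mul (by positivity) (by positivity),
      Real.log_mul (by positivity) (by positivity), Real.log_pow, Real.log_pow, Real.log_pow]
    norm_num
  have hint (t : ℝ) : IntervalIntegrable
      (fun θ => 2 * Real.log ‖circleMap 0 1 θ - (t : ℂ)‖) volume 0 (2 * π) :=
    (circleIntegrable_log_norm_sub_const (a := (t : ℂ)) (c := 0) 1).const_mul 2
  simp_rw [key]
  rw [integral_add intervalIntegrable_const ((hint r).add (hint (-r))),
    integral_add (hint r) (hint (-r)), intervalIntegral.integral_const, smul_eq_mul,
    intervalIntegral.integral_const_mul, intervalIntegral.integral_const_mul,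
    integral_log_norm_circleMap_sub_ofReal hr, integral_log_norm_circleMap_sub_ofReal hr']
  ring

theorem stmt_6 (ξ u : ℝ) (hξ : ξ ∈ Set.Ioo 0 (π / 2))
    (hu₁ : Real.cos ξ - Real.sqrt (Real.cos ξ ^ 2 + 1) < u) (hu₂ : u < 0) :
    (1 / (4 * π)) * (∫ θ in (0:ℝ)..(2 * π),
        Real.log ((1 - u ^ 2) ^ 2 + 4 * Real.cos ξ ^ 2 * u ^ 2 * Real.sin θ ^ 2))
      = Real.log ((1 - u ^ 2 + Real.sqrt (1 + 2 * Real.cos (2 * ξ) * u ^ 2 + u ^ 4)) / 2) := by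
  have hc : 0 < Real.cos ξ := Real.cos_pos_of_mem_Ioo ⟨by linarith [hξ.1, pi_pos], hξ.2⟩
  have hsqrt : Real.sqrt (Real.cos ξ ^ 2 + 1) ≤ Real.cos ξ + 1 :=
    Real.sqrt_le_iff.2 ⟨by linarith, by nlinarith⟩
  have ha : 0 < 1 - u ^ 2 := by nlinarith
  have hb : 4 * Real.cos ξ ^ 2 * u ^ 2 = (2 * Real.cos ξ * u) ^ 2 := by ring
  have hs : 1 + 2 * Real.cos (2 * ξ) * u ^ 2 + u ^ 4
      = (1 - u ^ 2) ^ 2 + (2 * Real.cos ξ * u) ^ 2 := by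
    rw [Real.cos_two_mul]
    ring
  rw [hb, hs, integral_log_sq_add_sq_mul_sin_sq ha]
  field_simp
end

section
/- Let ξ ∈ (0, π/2) and let u be any real number. Then the logarithmic zeta function of the one-dimensional two-state F-type quantum walk with parameter ξ satisfies ℒ(A^{(f)}, T¹_∞, u) = log((1 + u² + √(1 + 2 cos(2ξ) u² + u⁴))/2); explicitly, (1/(2π)) ∫₀^{2π} log(1 − 2 sin ξ cos θ · u + u²) dθ = log((1 + u² + √(1 + 2 cos(2ξ) u² + u⁴))/2). -/
open Real MeasureTheory intervalIntegral

theorem integral_log_one_sub_two_mul_cos_add_sq {r : ℝ} (hr : |r| < 1) :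
    ∫ θ in (0:ℝ)..(2 * π), Real.log (1 - 2 * r * Real.cos θ + r ^ 2) = 0 := by
  have havg : circleAverage (fun z : ℂ => Real.log ‖z - (r : ℂ)‖) 0 1 = 0 :=
    circleAverage_log_norm_sub_const₀ (by simpa using hr)
  have hnorm (θ : ℝ) : Real.log (1 - 2 * r * Real.cos θ + r ^ 2)
      = 2 * Real.log ‖circleMap 0 1 θ - (r : ℂ)‖ := by
    have hsq : ‖circleMap 0 1 θ - (r : ℂ)‖ ^ 2 = 1 - 2 * r * Real.cos θ + r ^ 2 := by
      rw [Complex.sq_norm, Complex.normSq_apply]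
      simp only [circleMap, zero_add, Complex.ofReal_one, one_mul, Complex.sub_re, Complex.sub_im,
        Complex.exp_ofReal_mul_I_re, Complex.exp_ofReal_mul_I_im, Complex.ofReal_re,
        Complex.ofReal_im]
      linear_combination Real.sin_sq_add_cos_sq θ
    rw [← hsq, Real.log_pow]
    norm_num
  simp_rw [hnorm]
  rw [circleAverage_def, smul_eq_mul] at havg
  rw [intervalIntegral.integral_const_mul,
    (mul_eq_zero.mp havg).resolve_left (by positivity), mul_zero]

theorem integral_log_sub_mul_cos {a b : ℝ} (hab : |b| < a) :
    (1 / (2 * π)) * (∫ θ in (0:ℝ)..(2 * π), Real.log (a - b * Real.cos θ))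
      = Real.log ((a + Real.sqrt (a ^ 2 - b ^ 2)) / 2) := by
  have ha : 0 < a := (abs_nonneg b).trans_lt hab
  have hD : Real.sqrt (a ^ 2 - b ^ 2) ^ 2 = a ^ 2 - b ^ 2 :=
    Real.sq_sqrt (sub_nonneg.mpr (sq_le_sq.mpr (by rw [abs_of_pos ha]; exact hab.le)))
  have hD0 := Real.sqrt_nonneg (a ^ 2 - b ^ 2)
  set M := (a + Real.sqrt (a ^ 2 - b ^ 2)) / 2 with hM
  have hMa : a ≤ 2 * M := by linarith
  have hM0 : 0 < M := by linarith
  have hquad : 4 * M ^ 2 - 4 * a * M + b ^ 2 = 0 := by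
    rw [hM]
    linear_combination hD
  set r := b / (2 * M) with hr
  have hr1 : |r| < 1 := by
    rw [hr, abs_div, abs_of_pos (by positivity : 0 < 2 * M), div_lt_one (by positivity)]
    linarith
  have hfac (θ : ℝ) : Real.log (a - b * Real.cos θ)
      = Real.log M + Real.log (1 - 2 * r * Real.cos θ + r ^ 2) := by
    have hmul : a - b * Real.cos θ = M * (1 - 2 * r * Real.cos θ + r ^ 2) := by
      rw [hr]
      field_simp
      linear_combination -hquad
    have hpos : 0 < a - b * Real.cos θ := by
      have h := (le_abs_self _).trans_eq (abs_mul b (Real.cos θ))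
      have := mul_le_of_le_one_right (abs_nonneg b) (Real.abs_cos_le_one θ)
      linarith
    rw [hmul] at hpos ⊢
    exact Real.log_mul hM0.ne' (pos_of_mul_pos_right hpos hM0.le).ne'
  have hcont : Continuous fun θ : ℝ => Real.log (1 - 2 * r * Real.cos θ + r ^ 2) := by
    refine Continuous.log (by fun_prop) fun θ => ?_
    have hr2 : r ^ 2 < 1 := (sq_lt_one_iff_abs_lt_one r).mpr hr1
    nlinarith [sq_nonneg (r - Real.cos θ), sq_nonneg (1 - r * Real.cos θ),
      Real.sin_sq_add_cos_sq θ, sq_nonneg (Real.sin θ)]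
  simp_rw [hfac]
  rw [intervalIntegral.integral_add intervalIntegrable_const (hcont.intervalIntegrable _ _),
    integral_log_one_sub_two_mul_cos_add_sq hr1, intervalIntegral.integral_const, smul_eq_mul]
  field_simp
  ring

theorem stmt_7 (ξ u : ℝ) (hξ : ξ ∈ Set.Ioo 0 (π / 2)) :
    (1 / (2 * π)) * (∫ θ in (0:ℝ)..(2 * π),
        Real.log (1 - 2 * Real.sin ξ * Real.cos θ * u + u ^ 2))
      = Real.log ((1 + u ^ 2 + Real.sqrt (1 + 2 * Real.cos (2 * ξ) * u ^ 2 + u ^ 4)) / 2) := by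
  have hcos : 0 < Real.cos ξ := Real.cos_pos_of_mem_Ioo ⟨by linarith [hξ.1, hξ.2], hξ.2⟩
  have hsin : 0 < Real.sin ξ := Real.sin_pos_of_pos_of_lt_pi hξ.1 (by linarith [hξ.2, Real.pi_pos])
  have hsin1 : Real.sin ξ < 1 := by nlinarith [Real.sin_sq_add_cos_sq ξ]
  have hab : |2 * Real.sin ξ * u| < 1 + u ^ 2 := by
    rw [abs_lt]
    constructor <;>
      nlinarith [sq_nonneg (u + Real.sin ξ), sq_nonneg (u - Real.sin ξ)]
  convert integral_log_sub_mul_cos hab using 5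
  · ring_nf
  · rw [Real.cos_two_mul]
    linear_combination 4 * u ^ 2 * Real.sin_sq_add_cos_sq ξ
end

section
/- Let ξ ∈ (0, π/2), let u < 0 be real, and set c^{(f)} = −(u + u^{-1})/sin ξ. Then the logarithmic zeta function of the one-dimensional two-state F-type quantum walk equals log(−sin ξ · u) plus the logarithmic Mahler measure of X + X^{-1} + c^{(f)}: (1/(2π)) ∫₀^{2π} log(1 − 2 sin ξ cos θ · u + u²) dθ = log(−sin ξ · u) + (1/(2π)) ∫₀^{2π} log|2 cos θ + c^{(f)}| dθ. -/
open Real MeasureTheory intervalIntegral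

theorem stmt_9 (ξ u : ℝ) (hξ : ξ ∈ Set.Ioo 0 (π / 2)) (hu : u < 0)
    (c : ℝ) (hc : c = -(u + u⁻¹) / Real.sin ξ) :
    (1 / (2 * π)) * (∫ θ in (0:ℝ)..(2 * π),
        Real.log (1 - 2 * Real.sin ξ * Real.cos θ * u + u ^ 2))
      = Real.log (-Real.sin ξ * u)
        + (1 / (2 * π)) * (∫ θ in (0:ℝ)..(2 * π), Real.log |2 * Real.cos θ + c|) := by
  obtain ⟨hξ0, hξ1⟩ := hξ
  have hs : 0 < Real.sin ξ := Real.sin_pos_of_pos_of_lt_pi hξ0 (by linarith [Real.pi_pos])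
  have hcos : 0 < Real.cos ξ := Real.cos_pos_of_mem_Ioo ⟨by linarith, hξ1⟩
  have hsu : 0 < -Real.sin ξ * u := by nlinarith
  have hpos (θ : ℝ) : 0 < 1 - 2 * Real.sin ξ * Real.cos θ * u + u ^ 2 := by
    have h : 1 - 2 * Real.sin ξ * Real.cos θ * u + u ^ 2
        = (u - Real.sin ξ * Real.cos θ) ^ 2 + (Real.sin ξ * Real.sin θ) ^ 2
          + Real.cos ξ ^ 2 := by
      linear_combination (-Real.sin ξ ^ 2) * Real.sin_sq_add_cos_sq θ
        - Real.sin_sq_add_cos_sq ξ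
    rw [h]
    positivity
  have hfactor (θ : ℝ) : 1 - 2 * Real.sin ξ * Real.cos θ * u + u ^ 2
      = (-Real.sin ξ * u) * (2 * Real.cos θ + c) := by
    have hu0 := hu.ne
    rw [hc]
    field_simp
    ring
  have hpos' (θ : ℝ) : 0 < 2 * Real.cos θ + c :=
    (mul_pos_iff_of_pos_left hsu).mp (hfactor θ ▸ hpos θ)
  have hlog (θ : ℝ) : Real.log (1 - 2 * Real.sin ξ * Real.cos θ * u + u ^ 2)
      = Real.log (-Real.sin ξ * u) + Real.log |2 * Real.cos θ + c| := by
    rw [hfactor, Real.log_abs, Real.log_mul hsu.ne' (hpos' θ).ne']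
  have hint : IntervalIntegrable (fun θ ↦ Real.log |2 * Real.cos θ + c|) volume 0 (2 * π) := by
    refine (Continuous.log (by fun_prop) fun θ ↦ ?_).intervalIntegrable _ _
    exact abs_ne_zero.mpr (hpos' θ).ne'
  simp_rw [hlog]
  rw [integral_add intervalIntegrable_const hint, intervalIntegral.integral_const, smul_eq_mul]
  have hπ := Real.pi_ne_zero
  field_simp
  ring
end

section
/- For the one-dimensional Hadamard walk (parameter ξ = π/4) of F-type and any real u < 0: (1/(2π)) ∫₀^{2π} log(1 − √2 cos θ · u + u²) dθ = log((1 + u² + √(1 + u⁴))/2) = log(−u/√2) + m(X + X^{-1} − √2 (u + u^{-1})), where m(X + X^{-1} − √2(u + u^{-1})) = log((−(u + u^{-1}) + √(u² + u^{-2}))/√2). -/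
open Real MeasureTheory intervalIntegral

theorem integral_log_one_add_sq_add_two_mul_cos {r : ℝ} (hr : 1 < r) :
    (1 / (2 * π)) * (∫ θ in (0:ℝ)..(2 * π), Real.log (1 + r ^ 2 + 2 * r * Real.cos θ))
      = 2 * Real.log r := by
  have h := circleAverage_log_norm_add_const_eq_posLog (a := (r : ℂ))
  have hn : ∀ θ : ℝ, Real.log ‖circleMap 0 1 θ + (r : ℂ)‖
      = 1 / 2 * Real.log (1 + r ^ 2 + 2 * r * Real.cos θ) := by
    intro θ
    have hs : ‖circleMap 0 1 θ + (r : ℂ)‖ ^ 2 = 1 + r ^ 2 + 2 * r * Real.cos θ := by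
      rw [← Complex.normSq_eq_norm_sq, Complex.normSq_apply]
      simp only [circleMap, Complex.ofReal_one, zero_add, one_mul, Complex.add_re, Complex.add_im,
        Complex.ofReal_re, Complex.ofReal_im, Complex.exp_ofReal_mul_I_re,
        Complex.exp_ofReal_mul_I_im]
      linear_combination Real.sin_sq_add_cos_sq θ
    rw [← hs, Real.log_pow]
    push_cast
    ring
  simp only [circleAverage_def, hn, intervalIntegral.integral_const_mul, smul_eq_mul] at h
  rw [Complex.norm_real, Real.norm_of_nonneg (by linarith), Real.posLog_eq_log] at h
  · rw [one_div]
    linear_combination 2 * h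
  · rw [abs_of_pos (by linarith)]
    exact hr.le

theorem integral_log_const_mul {c : ℝ} (hc : 0 < c) {f : ℝ → ℝ} (hf : Continuous f)
    (hpos : ∀ θ, 0 < f θ) :
    (1 / (2 * π)) * (∫ θ in (0:ℝ)..(2 * π), Real.log (c * f θ))
      = Real.log c + (1 / (2 * π)) * (∫ θ in (0:ℝ)..(2 * π), Real.log (f θ)) := by
  have hlog : Continuous fun θ => Real.log (f θ) := hf.log fun θ => (hpos θ).ne'
  simp_rw [fun θ => Real.log_mul hc.ne' (hpos θ).ne']
  rw [intervalIntegral.integral_add (by simp) (hlog.intervalIntegrable _ _)]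
  simp only [intervalIntegral.integral_const, smul_eq_mul]
  field_simp
  ring

theorem two_mul_cos_add_add_inv_pos {r : ℝ} (hr : 1 < r) (θ : ℝ) :
    0 < 2 * Real.cos θ + (r + r⁻¹) := by
  have h0 : 0 < r := by linarith
  have h : 2 * Real.cos θ + (r + r⁻¹) = r⁻¹ * ((r - 1) ^ 2 + 2 * r * (1 + Real.cos θ)) := by
    field_simp
    ring
  rw [h]
  have := Real.neg_one_le_cos θ
  have : 0 < (r - 1) ^ 2 := pow_pos (by linarith) 2
  have : 0 ≤ 2 * r * (1 + Real.cos θ) := mul_nonneg (by linarith) (by linarith)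
  positivity

theorem integral_log_two_mul_cos_add_add_inv {r : ℝ} (hr : 1 < r) :
    (1 / (2 * π)) * (∫ θ in (0:ℝ)..(2 * π), Real.log (2 * Real.cos θ + (r + r⁻¹)))
      = Real.log r := by
  have h0 : 0 < r := by linarith
  have h := integral_log_const_mul h0 (f := fun θ => 2 * Real.cos θ + (r + r⁻¹))
    (by fun_prop) (two_mul_cos_add_add_inv_pos hr)
  have he : ∀ θ, r * (2 * Real.cos θ + (r + r⁻¹)) = 1 + r ^ 2 + 2 * r * Real.cos θ := by
    intro θ
    field_simp
    ring
  simp_rw [he, integral_log_one_add_sq_add_two_mul_cos hr] at h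
  linarith

theorem stmt_10 (u : ℝ) (hu : u < 0) :
    (1 / (2 * π)) * (∫ θ in (0:ℝ)..(2 * π),
        Real.log (1 - Real.sqrt 2 * Real.cos θ * u + u ^ 2))
      = Real.log ((1 + u ^ 2 + Real.sqrt (1 + u ^ 4)) / 2) ∧
    (1 / (2 * π)) * (∫ θ in (0:ℝ)..(2 * π),
        Real.log (1 - Real.sqrt 2 * Real.cos θ * u + u ^ 2))
      = Real.log (-u / Real.sqrt 2)
        + (1 / (2 * π)) * (∫ θ in (0:ℝ)..(2 * π),
            Real.log |2 * Real.cos θ - Real.sqrt 2 * (u + u⁻¹)|) ∧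
    (1 / (2 * π)) * (∫ θ in (0:ℝ)..(2 * π),
        Real.log |2 * Real.cos θ - Real.sqrt 2 * (u + u⁻¹)|)
      = Real.log ((-(u + u⁻¹) + Real.sqrt (u ^ 2 + u⁻¹ ^ 2)) / Real.sqrt 2) := by
  have hu0 : u ≠ 0 := hu.ne
  have hq : Real.sqrt 2 ^ 2 = 2 := Real.sq_sqrt (by norm_num)
  have hq0 : 0 < Real.sqrt 2 := by positivity
  have hs : Real.sqrt (u ^ 2 + u⁻¹ ^ 2) ^ 2 = u ^ 2 + u⁻¹ ^ 2 := Real.sq_sqrt (by positivity)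
  have hs0 : 0 ≤ Real.sqrt (u ^ 2 + u⁻¹ ^ 2) := Real.sqrt_nonneg _
  have hs4 : Real.sqrt (1 + u ^ 4) = -u * Real.sqrt (u ^ 2 + u⁻¹ ^ 2) := by
    rw [Real.sqrt_eq_iff_mul_self_eq (by positivity) (mul_nonneg (by linarith) hs0)]
    have huu : u ^ 2 * u⁻¹ ^ 2 = 1 := by field_simp
    linear_combination -u ^ 2 * hs - huu
  set s := Real.sqrt (u ^ 2 + u⁻¹ ^ 2)
  set q := Real.sqrt 2
  set r := (-(u + u⁻¹) + s) / q with hr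
  have hinv : r⁻¹ = (-(u + u⁻¹) - s) / q := by
    refine inv_eq_of_mul_eq_one_right ?_
    rw [hr, div_mul_div_comm, div_eq_one_iff_eq (by positivity)]
    have huu : u * u⁻¹ = 1 := mul_inv_cancel₀ hu0
    linear_combination 2 * huu - hs - hq
  have hr1 : 1 < r := by
    rw [hr, one_lt_div hq0]
    have h2 : 2 ≤ -(u + u⁻¹) := by
      have : -(u + u⁻¹) - 2 = (u + 1) ^ 2 * (-u)⁻¹ := by
        field_simp
        ring
      have : 0 ≤ (u + 1) ^ 2 * (-u)⁻¹ :=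
        mul_nonneg (sq_nonneg _) (inv_nonneg.mpr (by linarith))
      linarith
    nlinarith
  have hsum : r + r⁻¹ = -(q * (u + u⁻¹)) := by
    rw [hinv, hr]
    field_simp
    rw [hq]
    ring
  have habs : ∀ θ, |2 * Real.cos θ - q * (u + u⁻¹)| = 2 * Real.cos θ + (r + r⁻¹) := by
    intro θ
    have := two_mul_cos_add_add_inv_pos hr1 θ
    rw [hsum] at this ⊢
    rw [sub_eq_add_neg, abs_of_pos this]
  have hc : 0 < -u / q := div_pos (by linarith) hq0
  have hfac : ∀ θ, 1 - q * Real.cos θ * u + u ^ 2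
      = -u / q * (2 * Real.cos θ + (r + r⁻¹)) := by
    intro θ
    rw [hsum]
    field_simp
    linear_combination -u * Real.cos θ * hq
  have hscale := integral_log_const_mul hc (f := fun θ => 2 * Real.cos θ + (r + r⁻¹))
    (by fun_prop) (two_mul_cos_add_add_inv_pos hr1)
  have hm := integral_log_two_mul_cos_add_add_inv hr1
  simp only [habs, hfac]
  refine ⟨?_, hscale, hm⟩
  rw [hscale, hm, ← Real.log_mul hc.ne' (by linarith), hs4, hr, div_mul_div_comm, ← pow_two, hq]
  congr 2
  field_simp
  ring
end

section
/- Let d be a positive integer and let u ∈ (−1, 0). Then the logarithmic zeta function of the d-dimensional F-type Grover walk satisfies ℒ(A^{(f)}, T^d_∞, u) = (d − 1) log(1 − u²) + log(−u/d) + m(Σ_{j=1}^{d}(X_j + X_j^{-1}) + c) with c = −d(u + u^{-1}); equivalently, ∫_{[0,2π)^d} log(1 − (2u/d) Σ_{j=1}^{d} cos θ_j + u²) dΘ^{(d)}_unif = log(−u/d) + ∫_{[0,2π)^d} log(Σ_{j=1}^{d} 2 cos θ_j − d(u + u^{-1})) dΘ^{(d)}_unif. -/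
open Real MeasureTheory

theorem sum_two_mul_cos_sub_pos {d : ℕ} (hd : 0 < d) {u : ℝ} (hu : u ∈ Set.Ioo (-1 : ℝ) 0)
    (θ : Fin d → ℝ) : 0 < ∑ j, 2 * Real.cos (θ j) - d * (u + u⁻¹) := by
  have hd' : (0 : ℝ) < d := by exact_mod_cast hd
  have hS : -(2 * d : ℝ) ≤ ∑ j, 2 * Real.cos (θ j) := by
    calc -(2 * d : ℝ) = ∑ _j : Fin d, (-2 : ℝ) := by simp [mul_comm]
      _ ≤ _ := Finset.sum_le_sum fun j _ => by linarith [Real.neg_one_le_cos (θ j)]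
  have hu' : u + u⁻¹ < -2 := by
    have h : u + u⁻¹ + 2 = (u + 1) ^ 2 / u := by
      field_simp [hu.2.ne]
      ring
    have : (u + 1) ^ 2 / u < 0 := div_neg_of_pos_of_neg (pow_pos (by linarith [hu.1]) 2) hu.2
    linarith
  nlinarith

theorem stmt_11 (d : ℕ) (hd : 0 < d) (u : ℝ) (hu : u ∈ Set.Ioo (-1 : ℝ) 0) :
    (1 / (2 * π) ^ d) * (∫ θ : Fin d → ℝ in Set.univ.pi fun _ => Set.Ico (0:ℝ) (2 * π),
        Real.log (1 - (2 * u / d) * ∑ j, Real.cos (θ j) + u ^ 2))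
      = Real.log (-u / d)
        + (1 / (2 * π) ^ d) * (∫ θ : Fin d → ℝ in Set.univ.pi fun _ => Set.Ico (0:ℝ) (2 * π),
            Real.log (∑ j, 2 * Real.cos (θ j) - d * (u + u⁻¹))) := by
  have hd' : (0 : ℝ) < d := by exact_mod_cast hd
  have hu0 : u ≠ 0 := hu.2.ne
  have hpos := sum_two_mul_cos_sub_pos hd hu
  have hlog (θ : Fin d → ℝ) : Real.log (1 - (2 * u / d) * ∑ j, Real.cos (θ j) + u ^ 2)
      = Real.log (-u / d) + Real.log (∑ j, 2 * Real.cos (θ j) - d * (u + u⁻¹)) := by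
    rw [← Real.log_mul (div_pos (neg_pos.2 hu.2) hd').ne' (hpos θ).ne', ← Finset.mul_sum]
    congr 1
    field_simp
    ring
  have hvol : volume (Set.univ.pi fun _ : Fin d => Set.Ico (0:ℝ) (2 * π))
      = ENNReal.ofReal ((2 * π) ^ d) := by
    simp [Real.volume_pi_Ico, ENNReal.ofReal_pow Real.two_pi_pos.le]
  have hcont : Continuous fun θ : Fin d → ℝ =>
      Real.log (∑ j, 2 * Real.cos (θ j) - d * (u + u⁻¹)) :=
    Continuous.log (by fun_prop) fun θ => (hpos θ).ne'
  have hint : IntegrableOn (fun θ : Fin d → ℝ =>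
      Real.log (∑ j, 2 * Real.cos (θ j) - d * (u + u⁻¹)))
      (Set.univ.pi fun _ => Set.Ico (0:ℝ) (2 * π)) :=
    (hcont.continuousOn.integrableOn_compact
      (isCompact_univ_pi fun _ => isCompact_Icc (a := (0:ℝ)) (b := 2 * π))).mono_set
      (Set.pi_mono fun _ _ => Set.Ico_subset_Icc_self)
  have hconst : IntegrableOn (fun _ : Fin d → ℝ => Real.log (-u / d))
      (Set.univ.pi fun _ => Set.Ico (0:ℝ) (2 * π)) :=
    integrableOn_const (by simp [hvol])
  simp_rw [hlog]
  rw [integral_add hconst hint, setIntegral_const, measureReal_def, hvol,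
    ENNReal.toReal_ofReal (by positivity), smul_eq_mul, mul_add, ← mul_assoc,
    one_div_mul_cancel (by positivity), one_mul]
end

section
/- For every real number c > 4, the logarithmic Mahler measure of X₁ + X₁^{-1} + X₂ + X₂^{-1} + c satisfies m(X₁ + X₁^{-1} + X₂ + X₂^{-1} + c) = log c − (2/c²) · ₄F₃(3/2, 3/2, 1, 1; 2, 2, 2; 16/c²); that is, ∫_{[0,2π)²} log(2 cos θ₁ + 2 cos θ₂ + c) dΘ^{(2)}_unif = log c − (2/c²) Σ_{n=0}^{∞} ((3/2)_n)² · n! / ((n+1)!)³ · (16/c²)^n. -/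
open Real MeasureTheory

/-- The odd power moments of `2 * cos` over a period vanish. -/
theorem integral_two_cos_pow_odd (k : ℕ) :
    ∫ x in (0:ℝ)..(2 * π), (2 * cos x) ^ (2 * k + 1) = 0 := by
  simp only [mul_pow, intervalIntegral.integral_const_mul]
  suffices h : ∫ x in (0:ℝ)..(2 * π), cos x ^ (2 * k + 1) = 0 by rw [h, mul_zero]
  induction k with
  | zero => simp
  | succ k ih =>
    rw [show 2 * (k + 1) + 1 = (2 * k + 1) + 2 by ring, integral_cos_pow, ih]
    simp

/-- The even power moments of `2 * cos` over a period are `2 * π` times the central binomial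
coefficients. -/
theorem integral_two_cos_pow_even (k : ℕ) :
    ∫ x in (0:ℝ)..(2 * π), (2 * cos x) ^ (2 * k) = 2 * π * k.centralBinom := by
  induction k with
  | zero => simp
  | succ k ih =>
    have hs : ((k:ℝ) + 1) * ((k + 1).centralBinom : ℝ) = 2 * (2 * k + 1) * k.centralBinom := by
      exact_mod_cast Nat.succ_mul_centralBinom_succ k
    simp only [mul_pow, intervalIntegral.integral_const_mul] at ih ⊢
    rw [show 2 * (k + 1) = 2 * k + 2 by ring, integral_cos_pow]
    have hk : (k:ℝ) + 1 ≠ 0 := by positivity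
    have h2 : ((k + 1).centralBinom : ℝ) = 2 * (2 * k + 1) * k.centralBinom / (k + 1) := by
      field_simp; linarith
    rw [h2, pow_add]
    simp only [sin_two_pi, sin_zero, mul_zero, sub_zero, zero_div, zero_add]
    push_cast
    calc _ = 2 ^ 2 * ((2 * k + 1) / (2 * k + 2))
          * (2 ^ (2 * k) * ∫ x in (0:ℝ)..(2 * π), cos x ^ (2 * k)) := by ring
      _ = _ := by
        rw [ih]
        have : (2:ℝ) * k + 2 ≠ 0 := by positivity
        field_simp

theorem sum_range_two_mul_add_one_of_odd_eq_zero (f : ℕ → ℝ) (hf : ∀ j, f (2 * j + 1) = 0)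
    (n : ℕ) : ∑ k ∈ Finset.range (2 * n + 1), f k = ∑ j ∈ Finset.range (n + 1), f (2 * j) := by
  induction n with
  | zero => simp
  | succ n ih =>
    rw [show 2 * (n + 1) + 1 = (2 * n + 1) + 1 + 1 by ring, Finset.sum_range_succ,
      Finset.sum_range_succ, ih, Finset.sum_range_succ _ (n + 1), hf, add_zero]
    rfl

theorem sum_choose_mul_centralBinom_mul_centralBinom (n : ℕ) :
    ∑ j ∈ Finset.range (n + 1),
      ((j.centralBinom : ℝ) * ((n - j).centralBinom : ℝ) * ((2 * n).choose (2 * j) : ℝ))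
        = (n.centralBinom : ℝ) ^ 2 := by
  have hsq : ∑ j ∈ Finset.range (n + 1), ((n.choose j : ℝ)) ^ 2 = n.centralBinom := by
    rw [Nat.centralBinom_eq_two_mul_choose]
    exact_mod_cast Nat.sum_range_choose_sq n
  rw [sq (n.centralBinom : ℝ)]
  nth_rewrite 2 [← hsq]
  rw [Finset.mul_sum]
  refine Finset.sum_congr rfl fun j hj => ?_
  obtain ⟨m, rfl⟩ := Nat.exists_eq_add_of_le (Nat.lt_succ_iff.1 (Finset.mem_range.1 hj))
  simp only [Nat.centralBinom_eq_two_mul_choose, add_tsub_cancel_left]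
  rw [Nat.cast_choose ℝ (show j ≤ 2 * j by omega), Nat.cast_choose ℝ (show m ≤ 2 * m by omega),
    Nat.cast_choose ℝ (show 2 * j ≤ 2 * (j + m) by omega),
    Nat.cast_choose ℝ (show j + m ≤ 2 * (j + m) by omega),
    Nat.cast_choose ℝ (show j ≤ j + m by omega),
    show 2 * j - j = j by omega, show 2 * m - m = m by omega,
    show 2 * (j + m) - 2 * j = 2 * m by omega, show 2 * (j + m) - (j + m) = j + m by omega,
    show j + m - j = m by omega]
  field_simp

/-- Lebesgue measure on the square `[0, 2π)²`. -/
noncomputable def squareMeasure : Measure (Fin 2 → ℝ) :=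
  Measure.pi fun _ => volume.restrict (Set.Ico (0:ℝ) (2 * π))

instance : IsFiniteMeasure squareMeasure := by
  unfold squareMeasure; infer_instance

theorem integral_squareMeasure_cos_pow_mul (k l : ℕ) :
    ∫ θ, (2 * cos (θ 0)) ^ k * (2 * cos (θ 1)) ^ l ∂squareMeasure
      = (∫ x in (0:ℝ)..(2 * π), (2 * cos x) ^ k) * ∫ x in (0:ℝ)..(2 * π), (2 * cos x) ^ l := by
  have h := integral_fintype_prod_eq_prod (𝕜 := ℝ)
    (μ := fun _ : Fin 2 => volume.restrict (Set.Ico (0:ℝ) (2 * π)))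
    (fun i x => (2 * cos x) ^ (![k, l] i))
  simp only [Fin.prod_univ_two, Matrix.cons_val_zero, Matrix.cons_val_one] at h
  rw [squareMeasure, h, intervalIntegral.integral_of_le (by positivity),
    intervalIntegral.integral_of_le (by positivity), integral_Ico_eq_integral_Ioc,
    integral_Ico_eq_integral_Ioc]

theorem integrable_squareMeasure_of_continuous_of_bounded {f : (Fin 2 → ℝ) → ℝ}
    (hf : Continuous f) {C : ℝ} (hC : ∀ θ, ‖f θ‖ ≤ C) : Integrable f squareMeasure :=
  Integrable.of_bound hf.aestronglyMeasurable C (Filter.Eventually.of_forall hC)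

theorem integral_squareMeasure_add_pow (n : ℕ) :
    ∫ θ, (2 * cos (θ 0) + 2 * cos (θ 1)) ^ n ∂squareMeasure
      = ∑ k ∈ Finset.range (n + 1), (∫ x in (0:ℝ)..(2 * π), (2 * cos x) ^ k)
          * (∫ x in (0:ℝ)..(2 * π), (2 * cos x) ^ (n - k)) * n.choose k := by
  have habs : ∀ x : ℝ, |2 * cos x| ≤ 2 := fun x => by
    rw [abs_mul, abs_two]; linarith [abs_cos_le_one x]
  simp only [add_pow]
  rw [integral_finsetSum]
  · refine Finset.sum_congr rfl fun k _ => ?_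
    rw [integral_mul_const, integral_squareMeasure_cos_pow_mul]
  · intro k _
    refine Integrable.mul_const (integrable_squareMeasure_of_continuous_of_bounded
      (by fun_prop) (C := 2 ^ k * 2 ^ (n - k)) fun θ => ?_) _
    rw [norm_mul, norm_pow, norm_pow]
    gcongr <;> exact habs _

theorem integral_squareMeasure_add_pow_odd (n : ℕ) :
    ∫ θ, (2 * cos (θ 0) + 2 * cos (θ 1)) ^ (2 * n + 1) ∂squareMeasure = 0 := by
  rw [integral_squareMeasure_add_pow]
  refine Finset.sum_eq_zero fun k hk => ?_
  have hk' := Finset.mem_range.1 hk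
  obtain ⟨j, rfl | rfl⟩ := Nat.even_or_odd' k
  · rw [show 2 * n + 1 - 2 * j = 2 * (n - j) + 1 by omega, integral_two_cos_pow_odd]
    simp
  · rw [integral_two_cos_pow_odd]
    simp

theorem integral_squareMeasure_add_pow_even (n : ℕ) :
    ∫ θ, (2 * cos (θ 0) + 2 * cos (θ 1)) ^ (2 * n) ∂squareMeasure
      = (2 * π) ^ 2 * (n.centralBinom : ℝ) ^ 2 := by
  rw [integral_squareMeasure_add_pow, sum_range_two_mul_add_one_of_odd_eq_zero,
    ← sum_choose_mul_centralBinom_mul_centralBinom, Finset.mul_sum]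
  · refine Finset.sum_congr rfl fun j _ => ?_
    rw [show 2 * n - 2 * j = 2 * (n - j) by omega, integral_two_cos_pow_even,
      integral_two_cos_pow_even]
    ring
  · intro j
    rw [integral_two_cos_pow_odd]
    simp

theorem ascPochhammer_eval_three_halves (n : ℕ) :
    (ascPochhammer ℝ n).eval ((3:ℝ) / 2)
      = (n + 1).centralBinom * ((n + 1).factorial : ℝ) * 2 / 4 ^ (n + 1) := by
  induction n with
  | zero => norm_num [Nat.centralBinom, Nat.choose]
  | succ n ih =>
    have hs : ((n:ℝ) + 2) * ((n + 2).centralBinom : ℝ)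
        = 2 * (2 * n + 3) * (n + 1).centralBinom := by
      have := Nat.succ_mul_centralBinom_succ (n + 1)
      have h : (((n + 1 + 1) * (n + 1 + 1).centralBinom : ℕ) : ℝ)
        = ((2 * (2 * (n + 1) + 1) * (n + 1).centralBinom : ℕ) : ℝ) := by rw [this]
      push_cast at h
      linear_combination h
    rw [ascPochhammer_succ_eval, ih, Nat.factorial_succ (n + 1)]
    push_cast
    rw [pow_succ (4:ℝ) (n + 1)]
    field_simp
    linear_combination (-2) * hs

theorem hasSum_integral_log (c : ℝ) (hc : 4 < c) :
    HasSum (fun n : ℕ => ∫ θ, (-(2 * cos (θ 0) + 2 * cos (θ 1)) / c) ^ (n + 1) / (n + 1)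
        ∂squareMeasure)
      (∫ θ, -log (1 - -(2 * cos (θ 0) + 2 * cos (θ 1)) / c) ∂squareMeasure) := by
  have hc0 : 0 < c := by linarith
  have hlt : 4 / c < 1 := (div_lt_one hc0).2 hc
  have hb : ∀ θ : Fin 2 → ℝ, |-(2 * cos (θ 0) + 2 * cos (θ 1)) / c| ≤ 4 / c := fun θ => by
    rw [abs_div, abs_of_pos hc0, abs_neg]
    gcongr
    rw [abs_le]
    constructor <;>
      linarith [cos_le_one (θ 0), cos_le_one (θ 1), neg_one_le_cos (θ 0), neg_one_le_cos (θ 1)]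
  have hsum : Summable fun n : ℕ => (4 / c) ^ (n + 1) :=
    (summable_nat_add_iff 1).2 (summable_geometric_of_lt_one (by positivity) hlt)
  refine hasSum_integral_of_dominated_convergence (fun n _ => (4 / c) ^ (n + 1)) ?_ ?_ ?_ ?_ ?_
  · exact fun n => Continuous.aestronglyMeasurable (by fun_prop)
  · refine fun n => Filter.Eventually.of_forall fun θ => ?_
    rw [norm_div, norm_pow, Real.norm_eq_abs, Real.norm_eq_abs,
      abs_of_nonneg (by positivity : (0:ℝ) ≤ (n:ℝ) + 1)]
    calc _ ≤ |-(2 * cos (θ 0) + 2 * cos (θ 1)) / c| ^ (n + 1) :=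
          div_le_self (by positivity) (by linarith [(Nat.cast_nonneg n : (0:ℝ) ≤ n)])
      _ ≤ _ := by gcongr; exact hb θ
  · exact Filter.Eventually.of_forall fun _ => hsum
  · exact integrable_const _
  · exact Filter.Eventually.of_forall fun θ =>
      hasSum_pow_div_log_of_abs_lt_one ((hb θ).trans_lt hlt)

theorem stmt_12 (c : ℝ) (hc : 4 < c) :
    (1 / (2 * π) ^ 2) * (∫ θ : Fin 2 → ℝ in Set.univ.pi fun _ => Set.Ico (0:ℝ) (2 * π),
        Real.log (2 * Real.cos (θ 0) + 2 * Real.cos (θ 1) + c))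
      = Real.log c - (2 / c ^ 2) * ∑' n : ℕ,
          ((ascPochhammer ℝ n).eval ((3:ℝ) / 2)) ^ 2 * (n.factorial : ℝ)
            / ((n + 1).factorial : ℝ) ^ 3 * (16 / c ^ 2) ^ n := by
  have hc0 : 0 < c := by linarith
  have hμ : (volume : Measure (Fin 2 → ℝ)).restrict
      (Set.univ.pi fun _ => Set.Ico (0:ℝ) (2 * π)) = squareMeasure := by
    rw [squareMeasure, volume_pi, Measure.restrict_pi_pi]
  rw [hμ]
  have hmass : squareMeasure.real Set.univ = (2 * π) ^ 2 := by
    have h := integral_squareMeasure_add_pow_even 0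
    simpa using h
  have h := hasSum_integral_log c hc
  have hterm : ∀ n : ℕ, ∫ θ, (-(2 * cos (θ 0) + 2 * cos (θ 1)) / c) ^ (n + 1) / (n + 1)
      ∂squareMeasure = (∫ θ, (2 * cos (θ 0) + 2 * cos (θ 1)) ^ (n + 1) ∂squareMeasure)
        * ((-1 / c) ^ (n + 1) / (n + 1)) := fun n => by
    rw [← integral_mul_const]
    congr 1 with θ
    rw [show -(2 * cos (θ 0) + 2 * cos (θ 1)) / c
      = (2 * cos (θ 0) + 2 * cos (θ 1)) * (-1 / c) by ring, mul_pow, mul_div_assoc]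
  simp only [hterm] at h
  have hinj : Function.Injective fun n : ℕ => 2 * n + 1 := fun a b hab => by
    simpa using hab
  rw [← hinj.hasSum_iff] at h
  swap
  · intro x hx
    obtain ⟨j, rfl | rfl⟩ := Nat.even_or_odd' x
    · rw [integral_squareMeasure_add_pow_odd, zero_mul]
    · exact absurd ⟨j, rfl⟩ hx
  have hseries : ∀ n : ℕ, (1 / (2 * π) ^ 2) *
      ((∫ θ, (2 * cos (θ 0) + 2 * cos (θ 1)) ^ (2 * n + 1 + 1) ∂squareMeasure)
        * ((-1 / c) ^ (2 * n + 1 + 1) / ((2 * n + 1 : ℕ) + 1)))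
      = (2 / c ^ 2) * (((ascPochhammer ℝ n).eval ((3:ℝ) / 2)) ^ 2 * (n.factorial : ℝ)
            / ((n + 1).factorial : ℝ) ^ 3 * (16 / c ^ 2) ^ n) := fun n => by
    rw [show 2 * n + 1 + 1 = 2 * (n + 1) by ring, integral_squareMeasure_add_pow_even,
      ascPochhammer_eval_three_halves, Nat.factorial_succ, pow_mul (-1 / c), div_pow (-1) c,
      div_pow 16, div_pow _ (c ^ 2), show (16:ℝ) = 4 ^ 2 by norm_num, ← pow_mul 4 2 n,
      mul_comm 2 n, pow_mul 4 n 2, pow_succ (4:ℝ) n, pow_succ (c ^ 2) n]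
    push_cast
    field_simp
    norm_num
    ring
  rw [← tsum_mul_left, ← tsum_congr hseries]
  have ht := (h.mul_left (1 / (2 * π) ^ 2)).tsum_eq
  simp only [Function.comp_def] at ht
  rw [ht]
  have hpos : ∀ θ : Fin 2 → ℝ, 0 < 2 * cos (θ 0) + 2 * cos (θ 1) + c := fun θ => by
    linarith [neg_one_le_cos (θ 0), neg_one_le_cos (θ 1)]
  have hlog : ∀ θ : Fin 2 → ℝ, -log (1 - -(2 * cos (θ 0) + 2 * cos (θ 1)) / c)
      = log c - log (2 * cos (θ 0) + 2 * cos (θ 1) + c) := fun θ => by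
    rw [show 1 - -(2 * cos (θ 0) + 2 * cos (θ 1)) / c
      = (2 * cos (θ 0) + 2 * cos (θ 1) + c) / c by field_simp; ring,
      log_div (hpos θ).ne' hc0.ne']
    ring
  have hint : Integrable (fun θ : Fin 2 → ℝ => log (2 * cos (θ 0) + 2 * cos (θ 1) + c))
      squareMeasure := by
    refine integrable_squareMeasure_of_continuous_of_bounded
      (Continuous.log (by fun_prop) fun θ => (hpos θ).ne')
      (C := max |log (c - 4)| |log (c + 4)|) fun θ => ?_
    refine abs_le_max_abs_abs (log_le_log (by linarith) ?_) (log_le_log (hpos θ) ?_) <;>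
      linarith [cos_le_one (θ 0), cos_le_one (θ 1), neg_one_le_cos (θ 0), neg_one_le_cos (θ 1)]
  simp only [hlog]
  rw [integral_sub (integrable_const _) hint, integral_const, hmass, smul_eq_mul]
  field_simp
  ring
end
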